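/- For all real numbers a, b, c, the 4×4 complex matrix exp(−(i/2)(a·σx⊗σx + b·σy⊗σy + c·σz⊗σz)) equals Σₖ e^{−i λₖ} |Φₖ⟩⟨Φₖ|, where λ₁ = (a−b+c)/2, λ₂ = (−a+b+c)/2, λ₃ = (−a−b−c)/2, λ₄ = (a+b−c)/2, and Φ₁, Φ₂, Φ₃, Φ₄ is the magic basis of ℂ²⊗ℂ²; here |Φₖ⟩⟨Φₖ| denotes the rank-one matrix whose ((i,j),(i',j')) entry is Φₖ(i,j)·conj(Φₖ(i',j')). -/

import Mathlib

open Matrix Kronecker Complex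

noncomputable def σx : Matrix (Fin 2) (Fin 2) ℂ := !![0, 1; 1, 0]
noncomputable def σy : Matrix (Fin 2) (Fin 2) ℂ := !![0, -I; I, 0]
noncomputable def σz : Matrix (Fin 2) (Fin 2) ℂ := !![1, 0; 0, -1]

/-- The standard basis vector `|ab⟩` of `ℂ²⊗ℂ²`. -/
noncomputable def ket (a b : Fin 2) : Fin 2 × Fin 2 → ℂ :=
  fun p => if p = (a, b) then 1 else 0

/-- The magic basis of `ℂ²⊗ℂ²`. -/
noncomputable def magicBasis : Fin 4 → (Fin 2 × Fin 2 → ℂ) :=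
  ![fun p => (ket 0 0 p + ket 1 1 p) / Real.sqrt 2,
    fun p => -I * (ket 0 0 p - ket 1 1 p) / Real.sqrt 2,
    fun p => (ket 0 1 p - ket 1 0 p) / Real.sqrt 2,
    fun p => -I * (ket 0 1 p + ket 1 0 p) / Real.sqrt 2]

/-- The phases `λₖ`. -/
noncomputable def lam (a b c : ℝ) : Fin 4 → ℝ :=
  ![(a - b + c) / 2, (-a + b + c) / 2, (-a - b - c) / 2, (a + b - c) / 2]

/-- The rank-one projector `|Φₖ⟩⟨Φₖ|` onto the k-th magic basis vector. -/
noncomputable def magicProj (k : Fin 4) : Matrix (Fin 2 × Fin 2) (Fin 2 × Fin 2) ℂ :=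
  Matrix.of fun p q => magicBasis k p * (starRingEnd ℂ) (magicBasis k q)

lemma sqrt_two_sq_c : ((Real.sqrt 2 : ℝ) : ℂ) ^ 2 = 2 := by
  rw [← Complex.ofReal_pow, Real.sq_sqrt (by norm_num)]; norm_num

lemma sqrt_two_ne_c : ((Real.sqrt 2 : ℝ) : ℂ) ≠ 0 := by
  intro h
  have := sqrt_two_sq_c
  rw [h] at this
  norm_num at this

lemma sqrt_two_inv_sq_c : (((Real.sqrt 2 : ℝ) : ℂ)⁻¹) ^ 2 = 1 / 2 := by
  rw [inv_pow, sqrt_two_sq_c]; norm_num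

lemma magic_inner (k l : Fin 4) :
    (star (magicBasis k)) ⬝ᵥ (magicBasis l) = if k = l then 1 else 0 := by
  have h := sqrt_two_inv_sq_c
  have hI := Complex.I_mul_I
  fin_cases k <;> fin_cases l <;>
    simp [magicBasis, ket, dotProduct, Fintype.sum_prod_type, div_eq_mul_inv] <;> grind

lemma magicProj_eq (k : Fin 4) :
    magicProj k = vecMulVec (magicBasis k) (star (magicBasis k)) := by
  ext p q
  simp [magicProj, vecMulVec]

lemma magicProj_mul (k l : Fin 4) :
    magicProj k * magicProj l = if k = l then magicProj k else 0 := by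
  rw [magicProj_eq, magicProj_eq, vecMulVec_mul_vecMulVec, magic_inner]
  split_ifs with h
  · subst h; simp
  · simp

lemma magic_sum (v : Fin 4 → ℂ) :
    ∑ k, v k • magicProj k = (v 0 / 2) • of (fun p q : Fin 2 × Fin 2 =>
        (ket 0 0 p + ket 1 1 p) * (ket 0 0 q + ket 1 1 q))
      + (v 1 / 2) • of (fun p q => (ket 0 0 p - ket 1 1 p) * (ket 0 0 q - ket 1 1 q))
      + (v 2 / 2) • of (fun p q => (ket 0 1 p - ket 1 0 p) * (ket 0 1 q - ket 1 0 q))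
      + (v 3 / 2) • of (fun p q => (ket 0 1 p + ket 1 0 p) * (ket 0 1 q + ket 1 0 q)) := by
  have h := sqrt_two_inv_sq_c
  have hI := Complex.I_mul_I
  have hk : ∀ a b p, (starRingEnd ℂ) (ket a b p) = ket a b p := by
    intro a b p; unfold ket; split_ifs <;> simp
  ext p q
  simp [Fin.sum_univ_four, magicProj, magicBasis, hk, div_eq_mul_inv]
  grind

noncomputable def magicHom : (Fin 4 → ℂ) →+* Matrix (Fin 2 × Fin 2) (Fin 2 × Fin 2) ℂ where
  toFun v := ∑ k, v k • magicProj k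
  map_one' := by
    rw [magic_sum]
    ext ⟨i, j⟩ ⟨i', j'⟩
    fin_cases i <;> fin_cases j <;> fin_cases i' <;> fin_cases j' <;>
      simp [ket] <;> norm_num
  map_mul' v w := by
    simp [Finset.sum_mul, Finset.mul_sum, magicProj_mul, smul_smul, mul_comm]
  map_zero' := by simp
  map_add' v w := by simp [add_smul, Finset.sum_add_distrib]

lemma magicHom_continuous : Continuous magicHom := by
  change Continuous fun v : Fin 4 → ℂ => ∑ k, v k • magicProj k
  fun_prop

lemma magicHom_exp (v : Fin 4 → ℂ) :
    magicHom (NormedSpace.exp v) = NormedSpace.exp (magicHom v) := by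
  rw [NormedSpace.exp_eq_tsum ℚ, NormedSpace.exp_eq_tsum ℚ]
  refine ((NormedSpace.expSeries_summable' (𝕂 := ℚ) v).hasSum.map magicHom
    magicHom_continuous).tsum_eq.symm.trans ?_
  dsimp only [Function.comp_def]
  simp_rw [map_rat_smul, map_pow]

theorem exp_eq_sum_magic_projections (a b c : ℝ) :
    NormedSpace.exp
        (-(I / 2) • ((a : ℂ) • (σx ⊗ₖ σx) + (b : ℂ) • (σy ⊗ₖ σy)
          + (c : ℂ) • (σz ⊗ₖ σz)))
      = ∑ k : Fin 4, Complex.exp (-(I * (lam a b c k : ℝ))) • magicProj k := by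
  have key := magicHom_exp (fun k => -(I * (lam a b c k : ℝ)))
  have e1 : magicHom (fun k => -(I * (lam a b c k : ℝ)))
      = -(I / 2) • ((a : ℂ) • (σx ⊗ₖ σx) + (b : ℂ) • (σy ⊗ₖ σy)
          + (c : ℂ) • (σz ⊗ₖ σz)) := by
    change ∑ k, (-(I * (lam a b c k : ℝ))) • magicProj k = _
    rw [magic_sum (fun k => -(I * (lam a b c k : ℝ)))]
    ext ⟨i, j⟩ ⟨i', j'⟩
    fin_cases i <;> fin_cases j <;> fin_cases i' <;> fin_cases j' <;>
      simp [ket, lam, σx, σy, σz] <;> ring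
  rw [← e1, ← key]
  change ∑ k, _ • magicProj k = _
  refine Finset.sum_congr rfl fun k _ => ?_
  rw [Pi.coe_exp, Complex.exp_eq_exp_ℂ]
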